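/- arXiv:2202.12669 — 6 statements merged into one kernel-verified Lean document; each statement's English description precedes it below -/
import Mathlib

section
/- For every countably infinite group G there exist permutations σ and τ of a countably infinite set Ω such that the subgroup ⟨σ, τ⟩ generated by σ and τ acts transitively on Ω, every orbit of the commutator [σ, τ] = σ ∘ τ ∘ σ⁻¹ ∘ τ⁻¹ on Ω is finite, and the centralizer of ⟨σ, τ⟩ in the symmetric group Sym(Ω) is isomorphic to G. -/
namespace VoltageOrigami

variable {G : Type*}

/-- The translation `(h, k) ↦ (h, k + 1)` of `G × ℤ`. -/
def shift (G : Type*) : Equiv.Perm (G × ℤ) :=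
  (Equiv.refl G).prodCongr (Equiv.addRight 1)

theorem shift_apply (h : G) (k : ℤ) : shift G (h, k) = (h, k + 1) := rfl

theorem shift_inv_apply (h : G) (k : ℤ) : (shift G)⁻¹ (h, k) = (h, k - 1) := rfl

theorem shift_zpow_apply (n : ℤ) (h : G) (k : ℤ) : (shift G ^ n) (h, k) = (h, k + n) := by
  induction n generalizing k with
  | zero => simp
  | succ n ih => rw [zpow_add_one, Equiv.Perm.mul_apply, shift_apply, ih]; ring_nf
  | pred n ih => rw [zpow_sub_one, Equiv.Perm.mul_apply, shift_inv_apply, ih]; ring_nf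

variable [Group G]

/-- The action of `g` on `G × ℤ` by left multiplication on the first factor, as a homomorphism. -/
def leftMul (G : Type*) [Group G] : G →* Equiv.Perm (G × ℤ) where
  toFun g := (Equiv.mulLeft g).prodCongr (Equiv.refl ℤ)
  map_one' := by ext <;> simp
  map_mul' a b := by ext <;> simp [mul_assoc]

/-- For every `n : ℕ`, exchange the fibres over `4 * n` and `4 * n + 2`, twisting by right
multiplication by `u n`; all other fibres are fixed pointwise. -/
def twistFun (u : ℕ → G) (x : G × ℤ) : G × ℤ :=
  if 0 ≤ x.2 ∧ x.2 % 4 = 0 then (x.1 * u (x.2 / 4).toNat, x.2 + 2)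
  else if 0 ≤ x.2 ∧ x.2 % 4 = 2 then (x.1 * (u (x.2 / 4).toNat)⁻¹, x.2 - 2)
  else x

theorem twistFun_zero (u : ℕ → G) (h : G) {k : ℤ} (h0 : 0 ≤ k) (h4 : k % 4 = 0) :
    twistFun u (h, k) = (h * u (k / 4).toNat, k + 2) := by
  simp [twistFun, h0, h4]

theorem twistFun_two (u : ℕ → G) (h : G) {k : ℤ} (h0 : 0 ≤ k) (h4 : k % 4 = 2) :
    twistFun u (h, k) = (h * (u (k / 4).toNat)⁻¹, k - 2) := by
  simp [twistFun, h0, h4]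

theorem twistFun_of_not (u : ℕ → G) (h : G) {k : ℤ} (hk : ¬(0 ≤ k ∧ k % 2 = 0)) :
    twistFun u (h, k) = (h, k) := by
  have h1 : ¬(0 ≤ k ∧ k % 4 = 0) := by omega
  have h2 : ¬(0 ≤ k ∧ k % 4 = 2) := by omega
  simp only [twistFun, if_neg h1, if_neg h2]

theorem twistFun_involutive (u : ℕ → G) : Function.Involutive (twistFun u) := by
  rintro ⟨h, k⟩
  by_cases hk : 0 ≤ k ∧ k % 2 = 0
  · obtain h4 | h4 : k % 4 = 0 ∨ k % 4 = 2 := by omega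
    · have hd : (k + 2) / 4 = k / 4 := by omega
      rw [twistFun_zero u h hk.1 h4, twistFun_two u _ (by omega) (by omega), hd]
      simp
    · have hd : (k - 2) / 4 = k / 4 := by omega
      rw [twistFun_two u h hk.1 h4, twistFun_zero u _ (by omega) (by omega), hd]
      simp
  · rw [twistFun_of_not u h hk, twistFun_of_not u h hk]

/-- The involution of `G × ℤ` given by `twistFun`. -/
def twist (u : ℕ → G) : Equiv.Perm (G × ℤ) := (twistFun_involutive u).toPerm

theorem twist_apply (u : ℕ → G) (x : G × ℤ) : twist u x = twistFun u x := rfl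

theorem twist_mul_self (u : ℕ → G) : twist u * twist u = 1 :=
  Equiv.ext (twistFun_involutive u)

theorem twist_inv (u : ℕ → G) : (twist u)⁻¹ = twist u :=
  inv_eq_of_mul_eq_one_left (twist_mul_self u)

theorem leftMul_apply (g h : G) (k : ℤ) : leftMul G g (h, k) = (g * h, k) := rfl

theorem leftMul_injective : Function.Injective (leftMul G) := fun a b hab => by
  simpa [leftMul_apply] using DFunLike.congr_fun hab ((1 : G), (0 : ℤ))

theorem commute_leftMul_shift (g : G) : Commute (leftMul G g) (shift G) := rfl

theorem commute_leftMul_twist (g : G) (u : ℕ → G) : Commute (leftMul G g) (twist u) := by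
  refine Equiv.ext ?_
  rintro ⟨h, k⟩
  simp only [Equiv.Perm.mul_apply, twist_apply, leftMul_apply]
  by_cases hk : 0 ≤ k ∧ k % 2 = 0
  · obtain h4 | h4 : k % 4 = 0 ∨ k % 4 = 2 := by omega
    · simp only [twistFun_zero u _ hk.1 h4, leftMul_apply, mul_assoc]
    · simp only [twistFun_two u _ hk.1 h4, leftMul_apply, mul_assoc]
  · simp only [twistFun_of_not u _ hk, leftMul_apply]

theorem disjoint_conj_shift_twist (u : ℕ → G) :
    (shift G * twist u * (shift G)⁻¹).Disjoint (twist u) := by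
  rintro ⟨h, k⟩
  by_cases hk : 0 ≤ k ∧ k % 2 = 0
  · left
    simp only [Equiv.Perm.mul_apply, shift_inv_apply, twist_apply]
    rw [twistFun_of_not u h (by omega), shift_apply, sub_add_cancel]
  · right
    exact twistFun_of_not u h hk

theorem commutator_sq (u : ℕ → G) :
    (shift G * twist u * (shift G)⁻¹ * (twist u)⁻¹) ^ 2 = 1 := by
  rw [twist_inv, (disjoint_conj_shift_twist u).commute.mul_pow, conj_pow, pow_two (twist u),
    twist_mul_self]
  simp

theorem exists_mem_closure_apply_eq {u : ℕ → G} (hu : Function.Surjective u) (a b : G × ℤ) :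
    ∃ g ∈ Subgroup.closure {shift G, twist u}, g a = b := by
  obtain ⟨h, k⟩ := a
  obtain ⟨h', k'⟩ := b
  obtain ⟨n, hn⟩ := hu (h⁻¹ * h')
  have hs : shift G ∈ Subgroup.closure {shift G, twist u} :=
    Subgroup.subset_closure (by simp)
  have ht : twist u ∈ Subgroup.closure {shift G, twist u} :=
    Subgroup.subset_closure (by simp)
  refine ⟨shift G ^ (k' - (4 * n + 2)) * twist u * shift G ^ (4 * n - k),
    mul_mem (mul_mem (zpow_mem hs _) ht) (zpow_mem hs _), ?_⟩
  have hd : (4 * (n : ℤ) / 4).toNat = n := by omega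
  simp only [Equiv.Perm.mul_apply, shift_zpow_apply, twist_apply]
  rw [add_sub_cancel, twistFun_zero u _ (by omega) (by omega), shift_zpow_apply, hd, hn]
  simp

/-- A permutation commuting with `shift G` and `twist u` preserves the fibre over `0`. -/
theorem apply_one_zero_snd {u : ℕ → G} {f : Equiv.Perm (G × ℤ)}
    (hs : Commute f (shift G)) (ht : Commute f (twist u)) : (f (1, 0)).2 = 0 := by
  obtain ⟨⟨g, m⟩, hf⟩ : ∃ y, f (1, 0) = y := ⟨_, rfl⟩
  have key (k : ℤ) : f (1, k) = (g, m + k) := by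
    have := DFunLike.congr_fun (hs.zpow_right k).eq ((1 : G), (0 : ℤ))
    simpa [Equiv.Perm.mul_apply, shift_zpow_apply, hf] using this
  have fixed_iff (k : ℤ) : twist u (1, k) = (1, k) ↔ twist u (g, m + k) = (g, m + k) := by
    have := DFunLike.congr_fun ht.eq ((1 : G), k)
    simp only [Equiv.Perm.mul_apply, key] at this
    rw [← this, ← key, f.injective.eq_iff]
  have moved (h : G) : twist u (h, 0) ≠ (h, 0) := fun h0 => by
    have := congrArg Prod.snd h0
    rw [twist_apply, twistFun_zero u h le_rfl rfl] at this
    simp at this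
  have nonneg {h : G} {k : ℤ} (hk : twist u (h, k) ≠ (h, k)) : 0 ≤ k := by
    by_contra hneg
    exact hk (twistFun_of_not u h fun H => hneg H.1)
  have h1 : 0 ≤ m := by
    simpa using nonneg (mt (fixed_iff 0).2 (moved 1))
  have h2 : 0 ≤ -m :=
    nonneg (mt (fixed_iff (-m)).1 (by simpa using moved g))
  rw [hf]
  dsimp only
  omega

theorem commute_leftMul_of_mem_closure (g : G) {u : ℕ → G} {c : Equiv.Perm (G × ℤ)}
    (hc : c ∈ Subgroup.closure {shift G, twist u}) : Commute (leftMul G g) c := by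
  have hle : Subgroup.closure {shift G, twist u} ≤ Subgroup.centralizer {leftMul G g} := by
    rw [Subgroup.closure_le]
    rintro _ (rfl | rfl)
    · exact Subgroup.mem_centralizer_singleton_iff.2 (commute_leftMul_shift g).symm.eq
    · exact Subgroup.mem_centralizer_singleton_iff.2 (commute_leftMul_twist g u).symm.eq
  exact (Subgroup.mem_centralizer_singleton_iff.1 (hle hc)).symm

theorem range_leftMul {u : ℕ → G} (hu : Function.Surjective u) :
    (leftMul G).range = Subgroup.centralizer
      (Subgroup.closure {shift G, twist u} : Set (Equiv.Perm (G × ℤ))) := by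
  apply le_antisymm
  · rintro _ ⟨g, rfl⟩
    exact Subgroup.mem_centralizer_iff.2 fun c hc =>
      (commute_leftMul_of_mem_closure g hc).symm.eq
  · intro f hf
    rw [Subgroup.mem_centralizer_iff] at hf
    have hs : Commute f (shift G) := (hf _ (Subgroup.subset_closure (by simp))).symm
    have ht : Commute f (twist u) := (hf _ (Subgroup.subset_closure (by simp))).symm
    have h0 : leftMul G (f (1, 0)).1 (1, 0) = f (1, 0) :=
      Prod.ext (mul_one _) (apply_one_zero_snd hs ht).symm
    refine ⟨(f (1, 0)).1, Equiv.ext fun x => ?_⟩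
    obtain ⟨c, hc, rfl⟩ := exists_mem_closure_apply_eq hu (1, 0) x
    rw [← Equiv.Perm.mul_apply, (commute_leftMul_of_mem_closure _ hc).eq,
      ← Equiv.Perm.mul_apply f, ← hf c hc, Equiv.Perm.mul_apply, Equiv.Perm.mul_apply, h0]

end VoltageOrigami

/-- For every countably infinite group `G` there exist permutations `σ` and `τ` of a
countably infinite set `Ω` such that `⟨σ, τ⟩` acts transitively on `Ω`, every orbit of the
commutator `σ ∘ τ ∘ σ⁻¹ ∘ τ⁻¹` on `Ω` is finite, and the centralizer of `⟨σ, τ⟩` in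
`Sym(Ω)` is isomorphic to `G`. -/
theorem stmt_0 (G : Type*) [Group G] [Countable G] [Infinite G]
    (Ω : Type*) [Countable Ω] [Infinite Ω] :
    ∃ σ τ : Equiv.Perm Ω,
      (∀ a b : Ω, ∃ g ∈ Subgroup.closure {σ, τ}, g a = b) ∧
      (∀ x : Ω,
        (MulAction.orbit (Subgroup.zpowers (σ * τ * σ⁻¹ * τ⁻¹)) x).Finite) ∧
      Nonempty (Subgroup.centralizer (↑(Subgroup.closure {σ, τ}) :
        Set (Equiv.Perm Ω)) ≃* G) := by
  obtain ⟨u, hu⟩ := exists_surjective_nat G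
  obtain ⟨e⟩ : Nonempty (G × ℤ ≃ Ω) := nonempty_equiv_of_countable
  let E : Equiv.Perm (G × ℤ) ≃* Equiv.Perm Ω := e.permCongrHom
  have hE (p : Equiv.Perm (G × ℤ)) (x : Ω) : E p x = e (p (e.symm x)) := rfl
  have hcl : Subgroup.closure {E (VoltageOrigami.shift G), E (VoltageOrigami.twist u)} =
      (Subgroup.closure {VoltageOrigami.shift G, VoltageOrigami.twist u}).map E.toMonoidHom := by
    rw [MonoidHom.map_closure, Set.image_pair]
    rfl
  refine ⟨E (VoltageOrigami.shift G), E (VoltageOrigami.twist u), fun a b => ?_, fun x => ?_, ?_⟩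
  · obtain ⟨g, hg, hab⟩ :=
      VoltageOrigami.exists_mem_closure_apply_eq hu (e.symm a) (e.symm b)
    refine ⟨E g, hcl ▸ Subgroup.mem_map_of_mem E.toMonoidHom hg, ?_⟩
    rw [hE, hab, e.apply_symm_apply]
  · have hfin : IsOfFinOrder (E (VoltageOrigami.shift G) * E (VoltageOrigami.twist u) *
        (E (VoltageOrigami.shift G))⁻¹ * (E (VoltageOrigami.twist u))⁻¹) := by
      refine isOfFinOrder_iff_pow_eq_one.2 ⟨2, two_pos, ?_⟩
      simp only [← map_inv, ← map_mul, ← map_pow, VoltageOrigami.commutator_sq, map_one]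
    have := hfin.finite_zpowers.to_subtype
    exact Set.finite_range _
  · have hcent : Subgroup.centralizer ((Subgroup.closure
        {E (VoltageOrigami.shift G), E (VoltageOrigami.twist u)} : Subgroup (Equiv.Perm Ω)) :
          Set (Equiv.Perm Ω)) = (VoltageOrigami.leftMul G).range.map E.toMonoidHom := by
      rw [hcl, VoltageOrigami.range_leftMul hu]
      ext f
      obtain ⟨p, rfl⟩ := E.surjective f
      simp only [Subgroup.mem_centralizer_iff, Subgroup.mem_map, SetLike.mem_coe,
        forall_exists_index, and_imp, forall_apply_eq_imp_iff₂, MulEquiv.coe_toMonoidHom,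
        E.injective.eq_iff, exists_eq_right, ← map_mul]
    rw [hcent]
    exact ⟨((MonoidHom.ofInjective VoltageOrigami.leftMul_injective).trans
      ((VoltageOrigami.leftMul G).range.equivMapOfInjective E.toMonoidHom E.injective)).symm⟩
end

section
/- For every finite group G there exist a nonempty finite set Ω and permutations σ and τ of Ω such that the subgroup ⟨σ, τ⟩ generated by σ and τ acts transitively on Ω and the centralizer of ⟨σ, τ⟩ in the symmetric group Sym(Ω) is isomorphic to G. -/
section ShearPair

/-- A permutation of `α` acting on the second factor of `α × α`. -/
def sndPerm {α : Type*} (c : Equiv.Perm α) : Equiv.Perm (α × α) :=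
  (Equiv.refl α).prodCongr c

@[simp] lemma sndPerm_apply {α : Type*} (c : Equiv.Perm α) (p : α × α) :
    sndPerm c p = (p.1, c p.2) := rfl

lemma sndPerm_pow_apply {α : Type*} (c : Equiv.Perm α) (n : ℕ) (p : α × α) :
    (sndPerm c ^ n) p = (p.1, (c ^ n) p.2) := by
  induction n with
  | zero => rfl
  | succ n ih => simp [pow_succ', ih]

variable {G : Type*} [Group G]

/-- The permutation `(g, x) ↦ (g * x, x)` of `G × G`. -/
def mulShear (G : Type*) [Group G] : Equiv.Perm (G × G) where
  toFun p := (p.1 * p.2, p.2)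
  invFun p := (p.1 * p.2⁻¹, p.2)
  left_inv p := by simp
  right_inv p := by simp

/-- Left multiplication by `G` on the first factor of `G × G`. -/
def fstMulLeft (G : Type*) [Group G] : G →* Equiv.Perm (G × G) where
  toFun h := (Equiv.mulLeft h).prodCongr (Equiv.refl G)
  map_one' := by ext p <;> simp
  map_mul' a b := by ext p <;> simp [mul_assoc]

@[simp] lemma mulShear_apply (p : G × G) : mulShear G p = (p.1 * p.2, p.2) := rfl

@[simp] lemma fstMulLeft_apply (h : G) (p : G × G) : fstMulLeft G h p = (h * p.1, p.2) := rfl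

lemma exists_mem_closure_sndPerm_mulShear {c : Equiv.Perm G}
    (hc : ∀ x y, ∃ n : ℕ, (c ^ n) x = y) (a b : G × G) :
    ∃ g ∈ Subgroup.closure {sndPerm c, mulShear G}, g a = b := by
  obtain ⟨m, hm⟩ := hc a.2 (a.1⁻¹ * b.1)
  obtain ⟨n, hn⟩ := hc (a.1⁻¹ * b.1) b.2
  have hs : sndPerm c ∈ Subgroup.closure {sndPerm c, mulShear G} :=
    Subgroup.subset_closure (by simp)
  have ht : mulShear G ∈ Subgroup.closure {sndPerm c, mulShear G} :=
    Subgroup.subset_closure (by simp)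
  refine ⟨sndPerm c ^ n * (mulShear G * sndPerm c ^ m),
    mul_mem (pow_mem hs n) (mul_mem ht (pow_mem hs m)), ?_⟩
  simp [sndPerm_pow_apply, hm, hn]

lemma fstMulLeft_mem_centralizer (c : Equiv.Perm G) (h : G) :
    fstMulLeft G h ∈ Subgroup.centralizer
      (Subgroup.closure {sndPerm c, mulShear G} : Set (Equiv.Perm (G × G))) := by
  have hle : Subgroup.closure {sndPerm c, mulShear G} ≤
      Subgroup.centralizer {fstMulLeft G h} := by
    rw [Subgroup.closure_le]
    rintro g (rfl | rfl) <;> rw [SetLike.mem_coe, Subgroup.mem_centralizer_singleton_iff] <;>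
      ext p <;> simp [mul_assoc]
  intro g hg
  exact Subgroup.mem_centralizer_singleton_iff.1 (hle hg)

/-- Only points of the form `(h, 1)` are fixed by the shear, so a permutation commuting with the
transitive group is determined by the first coordinate of its value at `(1, 1)`. -/
lemma exists_fstMulLeft_eq {c : Equiv.Perm G} (hc : ∀ x y, ∃ n : ℕ, (c ^ n) x = y)
    {f : Equiv.Perm (G × G)} (hf : f ∈ Subgroup.centralizer
      (Subgroup.closure {sndPerm c, mulShear G} : Set (Equiv.Perm (G × G)))) :
    ∃ h, fstMulLeft G h = f := by
  have comm : ∀ g ∈ Subgroup.closure {sndPerm c, mulShear G}, ∀ p, g (f p) = f (g p) :=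
    fun g hg p => DFunLike.congr_fun (hf g hg) p
  have hfix : (f (1, 1)).2 = 1 := by
    have := comm (mulShear G) (Subgroup.subset_closure (by simp)) (1, 1)
    simpa using congrArg Prod.fst this
  refine ⟨(f (1, 1)).1, Equiv.ext fun b => ?_⟩
  obtain ⟨g, hg, rfl⟩ := exists_mem_closure_sndPerm_mulShear hc (1, 1) b
  have hl : g (fstMulLeft G (f (1, 1)).1 (1, 1)) = fstMulLeft G (f (1, 1)).1 (g (1, 1)) :=
    DFunLike.congr_fun (fstMulLeft_mem_centralizer c (f (1, 1)).1 g hg) (1, 1)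
  rw [← hl, ← comm g hg]
  exact congrArg g (Prod.ext (by simp) hfix.symm)

lemma nonempty_centralizer_mulEquiv {c : Equiv.Perm G}
    (hc : ∀ x y, ∃ n : ℕ, (c ^ n) x = y) :
    Nonempty (Subgroup.centralizer
      (Subgroup.closure {sndPerm c, mulShear G} : Set (Equiv.Perm (G × G))) ≃* G) := by
  refine ⟨(MulEquiv.ofBijective
    ((fstMulLeft G).codRestrict _ (fstMulLeft_mem_centralizer c)) ⟨fun a b hab => ?_, ?_⟩).symm⟩
  · have := DFunLike.congr_fun (congrArg Subtype.val hab) ((1, 1) : G × G)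
    simpa using congrArg Prod.fst this
  · rintro ⟨f, hf⟩
    obtain ⟨h, hh⟩ := exists_fstMulLeft_eq hc hf
    exact ⟨h, Subtype.ext hh⟩

end ShearPair

lemma Equiv.Perm.exists_forall_exists_pow_apply_eq (α : Type*) [Finite α] :
    ∃ c : Equiv.Perm α, ∀ x y, ∃ n : ℕ, (c ^ n) x = y := by
  classical
  have := Fintype.ofFinite α
  obtain ⟨c, hc, -⟩ := (Finset.univ : Finset α).exists_cycleOn
  exact ⟨c, fun x y => let ⟨n, _, hn⟩ := hc.exists_pow_eq (Finset.mem_univ x) (Finset.mem_univ y)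
    ⟨n, hn⟩⟩

/-- For every finite group `G` there exist a nonempty finite set `Ω` and permutations
`σ`, `τ` of `Ω` such that `⟨σ, τ⟩` acts transitively on `Ω` and the centralizer of
`⟨σ, τ⟩` in `Sym(Ω)` is isomorphic to `G`. -/
theorem stmt_1 (G : Type*) [Group G] [Finite G] :
    ∃ (Ω : Type) (_ : Nonempty Ω) (_ : Finite Ω) (σ τ : Equiv.Perm Ω),
      (∀ a b : Ω, ∃ g ∈ Subgroup.closure {σ, τ}, g a = b) ∧
      Nonempty (Subgroup.centralizer (↑(Subgroup.closure {σ, τ}) :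
        Set (Equiv.Perm Ω)) ≃* G) := by
  have : Finite (Shrink.{0} G) := Finite.of_equiv G (equivShrink.{0} G)
  obtain ⟨c, hc⟩ := Equiv.Perm.exists_forall_exists_pow_apply_eq (Shrink.{0} G)
  obtain ⟨e⟩ := nonempty_centralizer_mulEquiv hc
  exact ⟨Shrink.{0} G × Shrink.{0} G, ⟨1⟩, inferInstance, sndPerm c, mulShear _,
    exists_mem_closure_sndPerm_mulShear hc, ⟨e.trans Shrink.mulEquiv⟩⟩
end

section
/- The subgroup of the symmetric group on the positive integers generated by σ and τ acts transitively on the positive integers. -/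
/-- Let `σ = (3,4)(6,7)(9,10)⋯` and `τ = (1,2,3)(4,5,6)(7,8,9)⋯` be permutations of the
positive integers.  Then the subgroup `⟨σ, τ⟩` of `Sym(ℕ+)` acts transitively on `ℕ+`. -/
theorem stmt_2 (σ τ : Equiv.Perm ℕ+)
    (hσ1 : σ 1 = 1) (hσ2 : σ 2 = 2)
    (hσ : ∀ k : ℕ+, σ (3 * k) = 3 * k + 1 ∧ σ (3 * k + 1) = 3 * k ∧
      σ (3 * k + 2) = 3 * k + 2)
    (hτ0 : τ 1 = 2 ∧ τ 2 = 3 ∧ τ 3 = 1)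
    (hτ : ∀ k : ℕ+, τ (3 * k + 1) = 3 * k + 2 ∧ τ (3 * k + 2) = 3 * k + 3 ∧
      τ (3 * k + 3) = 3 * k + 1) :
    ∀ m n : ℕ+, ∃ g ∈ Subgroup.closure {σ, τ}, g m = n := by
  have step : ∀ n : ℕ+, ∃ h ∈ Subgroup.closure {σ, τ}, h n = n + 1 := by
    intro n
    have hσm : σ ∈ Subgroup.closure {σ, τ} := Subgroup.subset_closure (by simp)
    have hτm : τ ∈ Subgroup.closure {σ, τ} := Subgroup.subset_closure (by simp)
    by_cases h1 : n = 1
    · exact ⟨τ, hτm, by rw [h1, hτ0.1]; rfl⟩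
    by_cases h2 : n = 2
    · exact ⟨τ, hτm, by rw [h2, hτ0.2.1]; rfl⟩
    have h1' : (n : ℕ) ≠ 1 := fun h => h1 (PNat.eq h)
    have h2' : (n : ℕ) ≠ 2 := fun h => h2 (PNat.eq h)
    have hpos := n.pos
    obtain ⟨k, hk⟩ : ∃ k : ℕ+, (k : ℕ) = n / 3 := ⟨⟨n / 3, by omega⟩, rfl⟩
    have cases3 : n = 3 * k ∨ n = 3 * k + 1 ∨ n = 3 * k + 2 := by
      simp only [← PNat.coe_inj, PNat.add_coe, PNat.mul_coe, PNat.val_ofNat]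
      omega
    rcases cases3 with h | h | h
    · exact ⟨σ, hσm, by rw [h, (hσ k).1]⟩
    · exact ⟨τ, hτm, by rw [h, (hτ k).1]; rfl⟩
    · exact ⟨τ, hτm, by rw [h, (hτ k).2.1]; rfl⟩
  have reach : ∀ n : ℕ+, ∃ g ∈ Subgroup.closure {σ, τ}, g 1 = n := by
    intro n
    induction n using PNat.recOn with
    | one => exact ⟨1, one_mem _, rfl⟩
    | succ n ih =>
      obtain ⟨g, hg, hgn⟩ := ih
      obtain ⟨h, hh, hhn⟩ := step n
      exact ⟨h * g, mul_mem hh hg, by rw [Equiv.Perm.mul_apply, hgn, hhn]⟩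
  intro m n
  obtain ⟨g, hg, hgm⟩ := reach m
  obtain ⟨h, hh, hhn⟩ := reach n
  exact ⟨h * g⁻¹, mul_mem hh (inv_mem hg), by simp [← hgm, hhn]⟩
end

section
/- Every orbit of the commutator c = σ ∘ τ ∘ σ⁻¹ ∘ τ⁻¹ of the permutations σ and τ on the positive integers is finite. -/
/-- Let `σ = (3,4)(6,7)(9,10)⋯` and `τ = (1,2,3)(4,5,6)(7,8,9)⋯` be permutations of the
positive integers.  Every orbit of their commutator `c = σ ∘ τ ∘ σ⁻¹ ∘ τ⁻¹` on `ℕ+` is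
finite. -/
theorem stmt_4 (σ τ : Equiv.Perm ℕ+)
    (hσ1 : σ 1 = 1) (hσ2 : σ 2 = 2)
    (hσ : ∀ k : ℕ+, σ (3 * k) = 3 * k + 1 ∧ σ (3 * k + 1) = 3 * k ∧
      σ (3 * k + 2) = 3 * k + 2)
    (hτ0 : τ 1 = 2 ∧ τ 2 = 3 ∧ τ 3 = 1)
    (hτ : ∀ k : ℕ+, τ (3 * k + 1) = 3 * k + 2 ∧ τ (3 * k + 2) = 3 * k + 3 ∧
      τ (3 * k + 3) = 3 * k + 1) :
    ∀ n : ℕ+,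
      (MulAction.orbit (Subgroup.zpowers (σ * τ * σ⁻¹ * τ⁻¹)) n).Finite := by
  have key : ∀ {a b d e f : ℕ+}, τ b = a → σ d = b → τ d = e → σ e = f →
      (σ * τ * σ⁻¹ * τ⁻¹) a = f := by
    rintro a b d e f rfl rfl rfl rfl
    simp
  have h31 : σ 3 = 4 := (hσ 1).1
  have h41 : σ 4 = 3 := (hσ 1).2.1
  have h51 : σ 5 = 5 := (hσ 1).2.2
  have t4 : τ 4 = 5 := (hτ 1).1
  have c1 : (σ * τ * σ⁻¹ * τ⁻¹) 1 = 5 := key hτ0.2.2 h41 t4 h51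
  have c2 : (σ * τ * σ⁻¹ * τ⁻¹) 2 = 2 := key hτ0.1 hσ1 hτ0.1 hσ2
  have c5 : (σ * τ * σ⁻¹ * τ⁻¹) 5 = 1 := key t4 h31 hτ0.2.2 hσ1
  have tlow : ∀ k : ℕ+, ∃ b : ℕ+, τ b = 3 * k ∧ σ b = b := by
    intro k
    induction k using PNat.recOn with
    | one => exact ⟨2, hτ0.2.1, hσ2⟩
    | succ k _ => exact ⟨3 * k + 2, (hτ k).2.1, (hσ k).2.2⟩
  have c30 : ∀ k : ℕ+, (σ * τ * σ⁻¹ * τ⁻¹) (3 * k) = 3 * k + 1 := by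
    intro k
    obtain ⟨b, hb, hs⟩ := tlow k
    exact key hb hs hb (hσ k).1
  have c31 : ∀ k : ℕ+, (σ * τ * σ⁻¹ * τ⁻¹) (3 * k + 1) = 3 * k + 5 := fun k =>
    key (hτ k).2.2 (hσ (k + 1)).2.1 (hτ (k + 1)).1 (hσ (k + 1)).2.2
  have c35 : ∀ k : ℕ+, (σ * τ * σ⁻¹ * τ⁻¹) (3 * k + 5) = 3 * k := fun k =>
    key (hτ (k + 1)).1 (hσ (k + 1)).1 (hτ k).2.2 (hσ k).2.1
  generalize σ * τ * σ⁻¹ * τ⁻¹ = c at *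
  have cases : ∀ n : ℕ+, n = 1 ∨ n = 2 ∨ n = 5 ∨
      ∃ k : ℕ+, n = 3 * k ∨ n = 3 * k + 1 ∨ n = 3 * k + 5 := by
    intro n
    by_cases h : n = 1 ∨ n = 2 ∨ n = 5
    · tauto
    · simp only [← PNat.coe_inj, PNat.val_ofNat] at h
      have hn := n.pos
      refine Or.inr (Or.inr (Or.inr ?_))
      by_cases h2 : (n : ℕ) % 3 = 2
      · obtain ⟨k, hk⟩ : ∃ k : ℕ+, (k : ℕ) = (n - 5) / 3 := ⟨⟨_, by omega⟩, rfl⟩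
        refine ⟨k, Or.inr (Or.inr (PNat.eq ?_))⟩
        simp only [PNat.add_coe, PNat.mul_coe, PNat.val_ofNat]
        omega
      · obtain ⟨k, hk⟩ : ∃ k : ℕ+, (k : ℕ) = n / 3 := ⟨⟨_, by omega⟩, rfl⟩
        refine ⟨k, ?_⟩
        simp only [← PNat.coe_inj, PNat.add_coe, PNat.mul_coe, PNat.val_ofNat]
        omega
  have hc : c ^ 6 = 1 := by
    ext1 n
    rcases cases n with rfl | rfl | rfl | ⟨k, rfl | rfl | rfl⟩ <;>
      simp only [pow_succ, pow_zero, one_mul, Equiv.Perm.mul_apply, Equiv.Perm.one_apply,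
        c1, c2, c5, c30, c31, c35]
  have : Finite (Subgroup.zpowers c) :=
    finite_zpowers.2 (isOfFinOrder_iff_pow_eq_one.2 ⟨6, by norm_num, hc⟩)
  exact fun n => Set.finite_range _
end

section
/- The commutator c = σ ∘ τ ∘ σ⁻¹ ∘ τ⁻¹ of the permutations σ and τ has exactly one fixed point among the positive integers, namely the point 2. -/
/-- Let `σ = (3,4)(6,7)(9,10)⋯` and `τ = (1,2,3)(4,5,6)(7,8,9)⋯` be permutations of the
positive integers.  Their commutator `c = σ ∘ τ ∘ σ⁻¹ ∘ τ⁻¹` has exactly one fixed point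
among the positive integers, namely `2`. -/
theorem stmt_5 (σ τ : Equiv.Perm ℕ+)
    (hσ1 : σ 1 = 1) (hσ2 : σ 2 = 2)
    (hσ : ∀ k : ℕ+, σ (3 * k) = 3 * k + 1 ∧ σ (3 * k + 1) = 3 * k ∧
      σ (3 * k + 2) = 3 * k + 2)
    (hτ0 : τ 1 = 2 ∧ τ 2 = 3 ∧ τ 3 = 1)
    (hτ : ∀ k : ℕ+, τ (3 * k + 1) = 3 * k + 2 ∧ τ (3 * k + 2) = 3 * k + 3 ∧
      τ (3 * k + 3) = 3 * k + 1) :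
    (σ * τ * σ⁻¹ * τ⁻¹) 2 = 2 ∧
      ∀ n : ℕ+, (σ * τ * σ⁻¹ * τ⁻¹) n = n → n = 2 := by
  have exists_eq_three_mul_add (n : ℕ+) : n = 1 ∨ n = 2 ∨ n = 3 ∨
      ∃ k : ℕ+, n = 3 * k + 1 ∨ n = 3 * k + 2 ∨ n = 3 * k + 3 := by
    have hn := n.pos
    by_cases h : 3 < (n : ℕ)
    · obtain ⟨k, hk⟩ : ∃ k : ℕ+, (k : ℕ) = ((n : ℕ) - 1) / 3 := ⟨⟨_, by omega⟩, rfl⟩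
      refine Or.inr (Or.inr (Or.inr ⟨k, ?_⟩))
      simp only [← PNat.coe_inj, PNat.add_coe, PNat.mul_coe, PNat.val_ofNat]
      omega
    · simp only [← PNat.coe_inj, PNat.val_ofNat]
      omega
  have hσ3 : σ 3 = 4 := (hσ 1).1
  have hσ_succ (k : ℕ+) : σ (3 * k + 3) = 3 * k + 4 := (hσ (k + 1)).1
  have eq_one_of_commute (y : ℕ+) (h : σ (τ y) = τ (σ y)) : y = 1 := by
    rcases exists_eq_three_mul_add y with rfl | rfl | rfl | ⟨k, rfl | rfl | rfl⟩
    · rfl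
    · rw [hτ0.2.1, hσ2, hτ0.2.1, hσ3] at h
      exact absurd h (by decide)
    · rw [hτ0.2.2, hσ1, hσ3, show τ 4 = 5 from (hτ 1).1] at h
      exact absurd h (by decide)
    · rw [(hτ k).1, (hσ k).2.2, (hσ k).2.1] at h
      have h' : τ (3 * k) = τ (3 * k + 1) := h.symm.trans (hτ k).1.symm
      have := congrArg PNat.val (τ.injective h')
      simp at this
    · rw [(hτ k).2.1, hσ_succ, (hσ k).2.2, (hτ k).2.1] at h
      exact absurd (add_left_cancel h) (by decide)
    · rw [(hτ k).2.2, (hσ k).2.1, hσ_succ,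
        show τ (3 * k + 4) = 3 * k + 5 from (hτ (k + 1)).1] at h
      have := congrArg PNat.val h
      simp at this
  have hτ_inv : τ⁻¹ 2 = 1 := Equiv.Perm.inv_eq_iff_eq.mpr hτ0.1.symm
  have hσ_inv : σ⁻¹ 1 = 1 := Equiv.Perm.inv_eq_iff_eq.mpr hσ1.symm
  refine ⟨by simp only [Equiv.Perm.mul_apply, hτ_inv, hσ_inv, hτ0.1, hσ2], fun n hn => ?_⟩
  simp only [Equiv.Perm.mul_apply] at hn
  have hy : σ⁻¹ (τ⁻¹ n) = 1 := eq_one_of_commute _ (hn.trans (by simp))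
  rw [hy, hτ0.1, hσ2] at hn
  exact hn.symm
end

section
/- For the commutator c = σ ∘ τ ∘ σ⁻¹ ∘ τ⁻¹ of the permutations σ and τ: the orbit of 1 under c is {1, 5} and has exactly two elements; the orbit of 2 is {2}; and for every k ≥ 1 the orbit of 3k under c is {3k, 3k+1, 3k+5} and has exactly three elements. Every positive integer lies in exactly one of these orbits. -/
/-- A set fixed by a permutation contains the whole cycle of each of its points. -/
theorem orbit_zpowers_subset_of_image_eq {α : Type*} {c : Equiv.Perm α} {s : Set α} {a : α}
    (hs : c '' s = s) (ha : a ∈ s) : MulAction.orbit (Subgroup.zpowers c) a ⊆ s := by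
  have hc : Set.BijOn c s s := ⟨Set.mapsTo_iff_image_subset.2 hs.le, c.injective.injOn, hs.ge⟩
  rintro _ ⟨⟨_, i, rfl⟩, rfl⟩
  exact (hc.perm_zpow i).mapsTo ha

theorem apply_mem_orbit_zpowers {α : Type*} {c : Equiv.Perm α} {a x : α}
    (hx : x ∈ MulAction.orbit (Subgroup.zpowers c) a) :
    c x ∈ MulAction.orbit (Subgroup.zpowers c) a :=
  MulAction.mem_orbit_of_mem_orbit (⟨c, Subgroup.mem_zpowers c⟩ : Subgroup.zpowers c) hx

theorem orbit_zpowers_of_apply_eq_self {α : Type*} {c : Equiv.Perm α} {a : α} (h : c a = a) :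
    MulAction.orbit (Subgroup.zpowers c) a = {a} := by
  refine (orbit_zpowers_subset_of_image_eq (by simp [h]) (by simp)).antisymm ?_
  exact Set.singleton_subset_iff.2 (MulAction.mem_orbit_self a)

theorem orbit_zpowers_of_two_cycle {α : Type*} {c : Equiv.Perm α} {a b : α}
    (hab : c a = b) (hba : c b = a) :
    MulAction.orbit (Subgroup.zpowers c) a = {a, b} := by
  refine (orbit_zpowers_subset_of_image_eq ?_ (by simp)).antisymm ?_
  · rw [Set.image_pair, hab, hba, Set.pair_comm]
  · have ha := MulAction.mem_orbit_self (M := Subgroup.zpowers c) a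
    have hb := hab ▸ apply_mem_orbit_zpowers ha
    rintro x (rfl | rfl) <;> assumption

theorem orbit_zpowers_of_three_cycle {α : Type*} {c : Equiv.Perm α} {a b d : α}
    (hab : c a = b) (hbd : c b = d) (hda : c d = a) :
    MulAction.orbit (Subgroup.zpowers c) a = {a, b, d} := by
  refine (orbit_zpowers_subset_of_image_eq ?_ (by simp)).antisymm ?_
  · rw [Set.image_insert_eq, Set.image_pair, hab, hbd, hda, Set.pair_comm, Set.insert_comm]
  · have ha := MulAction.mem_orbit_self (M := Subgroup.zpowers c) a
    have hb := hab ▸ apply_mem_orbit_zpowers ha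
    have hd := hbd ▸ apply_mem_orbit_zpowers hb
    rintro x (rfl | rfl | rfl) <;> assumption

/-- The commutator is computed by following a point backwards along `τ` and `σ`,
then forwards. -/
theorem commutator_apply_of_path {α : Type*} {σ τ : Equiv.Perm α} {x p q r y : α}
    (hp : τ p = x) (hq : σ q = p) (hr : τ q = r) (hy : σ r = y) :
    (σ * τ * σ⁻¹ * τ⁻¹) x = y := by
  subst hp hq hr hy
  simp

theorem eq_of_mem_three_cycles {k l n : ℕ+}
    (hk : n ∈ ({3 * k, 3 * k + 1, 3 * k + 5} : Set ℕ+))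
    (hl : n ∈ ({3 * l, 3 * l + 1, 3 * l + 5} : Set ℕ+)) : k = l := by
  simp only [Set.mem_insert_iff, Set.mem_singleton_iff, ← PNat.coe_inj, PNat.add_coe,
    PNat.mul_coe, PNat.val_ofNat] at hk hl ⊢
  omega

/-- Let `σ = (3,4)(6,7)(9,10)⋯` and `τ = (1,2,3)(4,5,6)(7,8,9)⋯` be permutations of the
positive integers, and let `c = σ ∘ τ ∘ σ⁻¹ ∘ τ⁻¹` be their commutator.  The orbit of `1`
under `c` is `{1, 5}` (two elements), the orbit of `2` is `{2}`, for every `k ≥ 1` the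
orbit of `3k` is `{3k, 3k+1, 3k+5}` (three elements), and every positive integer lies in
exactly one of these orbits. -/
theorem stmt_6 (σ τ : Equiv.Perm ℕ+)
    (hσ1 : σ 1 = 1) (hσ2 : σ 2 = 2)
    (hσ : ∀ k : ℕ+, σ (3 * k) = 3 * k + 1 ∧ σ (3 * k + 1) = 3 * k ∧
      σ (3 * k + 2) = 3 * k + 2)
    (hτ0 : τ 1 = 2 ∧ τ 2 = 3 ∧ τ 3 = 1)
    (hτ : ∀ k : ℕ+, τ (3 * k + 1) = 3 * k + 2 ∧ τ (3 * k + 2) = 3 * k + 3 ∧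
      τ (3 * k + 3) = 3 * k + 1) :
    (MulAction.orbit (Subgroup.zpowers (σ * τ * σ⁻¹ * τ⁻¹)) (1 : ℕ+)
        = ({1, 5} : Set ℕ+)) ∧
    ({1, 5} : Set ℕ+).ncard = 2 ∧
    (MulAction.orbit (Subgroup.zpowers (σ * τ * σ⁻¹ * τ⁻¹)) (2 : ℕ+)
        = ({2} : Set ℕ+)) ∧
    (∀ k : ℕ+,
      MulAction.orbit (Subgroup.zpowers (σ * τ * σ⁻¹ * τ⁻¹)) (3 * k)
          = ({3 * k, 3 * k + 1, 3 * k + 5} : Set ℕ+) ∧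
      ({3 * k, 3 * k + 1, 3 * k + 5} : Set ℕ+).ncard = 3) ∧
    (∀ n : ℕ+, ∃! S : Set ℕ+,
      S ∈ insert ({1, 5} : Set ℕ+) (insert ({2} : Set ℕ+)
        (Set.range fun k : ℕ+ => ({3 * k, 3 * k + 1, 3 * k + 5} : Set ℕ+))) ∧
      n ∈ S) := by
  have hk3 (k : ℕ+) : (3 * k + 3 : ℕ+) = 3 * (k + 1) := by ring
  have hk5 (k : ℕ+) : (3 * k + 5 : ℕ+) = 3 * (k + 1) + 2 := by
    apply PNat.eq; push_cast; ring
  have hσ3 : σ 3 = 4 := (hσ 1).1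
  have hσ4 : σ 4 = 3 := (hσ 1).2.1
  have hσ5 : σ 5 = 5 := (hσ 1).2.2
  have hτ4 : τ 4 = 5 := (hτ 1).1
  have hfirst (k : ℕ+) : (σ * τ * σ⁻¹ * τ⁻¹) (3 * k) = 3 * k + 1 := by
    induction k using PNat.recOn with
    | one => exact commutator_apply_of_path hτ0.2.1 hσ2 hτ0.2.1 hσ3
    | succ k _ =>
      rw [← hk3]
      refine commutator_apply_of_path (hτ k).2.1 (hσ k).2.2 (hτ k).2.1 ?_
      rw [hk3]
      exact (hσ (k + 1)).1
  have hsecond (k : ℕ+) : (σ * τ * σ⁻¹ * τ⁻¹) (3 * k + 1) = 3 * k + 5 := by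
    refine commutator_apply_of_path (hτ k).2.2 (q := 3 * (k + 1) + 1) ?_ (hτ (k + 1)).1 ?_
    · rw [hk3]; exact (hσ (k + 1)).2.1
    · rw [hk5]; exact (hσ (k + 1)).2.2
  have hthird (k : ℕ+) : (σ * τ * σ⁻¹ * τ⁻¹) (3 * k + 5) = 3 * k := by
    refine commutator_apply_of_path (p := 3 * (k + 1) + 1) ?_ (hσ (k + 1)).1 ?_ (hσ k).2.1
    · rw [hk5]; exact (hτ (k + 1)).1
    · rw [← hk3]; exact (hτ k).2.2
  refine ⟨orbit_zpowers_of_two_cycle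
      (commutator_apply_of_path hτ0.2.2 hσ4 hτ4 hσ5)
      (commutator_apply_of_path hτ4 hσ3 hτ0.2.2 hσ1),
    Set.ncard_pair (by decide),
    orbit_zpowers_of_apply_eq_self (commutator_apply_of_path hτ0.1 hσ1 hτ0.1 hσ2),
    fun k => ⟨orbit_zpowers_of_three_cycle (hfirst k) (hsecond k) (hthird k), ?_⟩,
    fun n => ?_⟩
  · rw [Set.ncard_eq_three]
    refine ⟨_, _, _, ?_, ?_, ?_, rfl⟩ <;>
      simp only [ne_eq, ← PNat.coe_inj, PNat.add_coe, PNat.mul_coe, PNat.val_ofNat] <;> omega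
  · have hdisj1 (k : ℕ+) (h : n ∈ ({3 * k, 3 * k + 1, 3 * k + 5} : Set ℕ+)) :
        n ≠ 1 ∧ n ≠ 2 ∧ n ≠ 5 := by
      have := k.pos
      simp only [Set.mem_insert_iff, Set.mem_singleton_iff, ne_eq, ← PNat.coe_inj,
        PNat.add_coe, PNat.mul_coe, PNat.val_ofNat] at h ⊢
      omega
    have hcover : n = 1 ∨ n = 5 ∨ n = 2 ∨
        ∃ k : ℕ+, n ∈ ({3 * k, 3 * k + 1, 3 * k + 5} : Set ℕ+) := by
      by_contra! h
      obtain ⟨h1, h5, h2, h⟩ := h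
      have hn := n.pos
      have hk (k : ℕ+) :
          (n : ℕ) ≠ 3 * k ∧ (n : ℕ) ≠ 3 * k + 1 ∧ (n : ℕ) ≠ 3 * k + 5 := by
        simpa only [Set.mem_insert_iff, Set.mem_singleton_iff, not_or, ← PNat.coe_inj,
          PNat.add_coe, PNat.mul_coe, PNat.val_ofNat] using h k
      have hm (m : ℕ) (hpos : 0 < m) :
          (n : ℕ) ≠ 3 * m ∧ (n : ℕ) ≠ 3 * m + 1 ∧ (n : ℕ) ≠ 3 * m + 5 := hk ⟨m, hpos⟩
      simp only [ne_eq, ← PNat.coe_inj, PNat.val_ofNat] at h1 h2 h5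
      have hdiv := hm (n / 3)
      have hpred := hm (n / 3 - 1)
      omega
    rcases hcover with rfl | rfl | rfl | ⟨k, hk⟩
    · refine ⟨{1, 5}, by simp, ?_⟩
      rintro S ⟨rfl | rfl | ⟨l, rfl⟩, hS⟩
      · rfl
      · simp at hS
      · exact absurd rfl (hdisj1 l hS).1
    · refine ⟨{1, 5}, by simp, ?_⟩
      rintro S ⟨rfl | rfl | ⟨l, rfl⟩, hS⟩
      · rfl
      · exact absurd hS (by decide)
      · exact absurd rfl (hdisj1 l hS).2.2
    · refine ⟨{2}, by simp, ?_⟩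
      rintro S ⟨rfl | rfl | ⟨l, rfl⟩, hS⟩
      · exact absurd hS (by decide)
      · rfl
      · exact absurd rfl (hdisj1 l hS).2.1
    · refine ⟨{3 * k, 3 * k + 1, 3 * k + 5}, ⟨.inr (.inr ⟨k, rfl⟩), hk⟩, ?_⟩
      obtain ⟨h1, h2, h5⟩ := hdisj1 k hk
      rintro S ⟨rfl | rfl | ⟨l, rfl⟩, hS⟩
      · exact (hS.elim h1 h5).elim
      · exact (h2 hS).elim
      · rw [eq_of_mem_three_cycles hk hS]
end
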